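/- arXiv:2602.22909 — 4 statements merged into one kernel-verified Lean document; each statement's English description precedes it below -/
import Mathlib

section
/- Let (V,q) be a finite-dimensional quadratic space over ℚ with q anisotropic, and let k ≥ 1 be an integer. For any two k-dimensional positive definite subspaces W₁, W₂ of V there exist an integer t ≥ 0 and a sequence U₀ = W₁, U₁, …, U_{t-1}, U_t = W₂ of k-dimensional positive definite subspaces of V such that dim(U_i ∩ U_{i+1}) = k−1 for every 0 ≤ i ≤ t−1. -/
/-- A subspace `W` of a rational quadratic space `(V, Q)` is *positive definite*
if `Q w > 0` for every nonzero `w ∈ W`. -/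
def Submodule.IsPosDef {V : Type*} [AddCommGroup V] [Module ℚ V]
    (Q : QuadraticForm ℚ V) (W : Submodule ℚ V) : Prop :=
  ∀ w ∈ W, w ≠ 0 → 0 < Q w

open Module in
/-- A positive definite subspace `U` can be enlarged by a vector of any positive definite subspace
of larger dimension. -/
theorem Submodule.IsPosDef.exists_sup_span_singleton
    {V : Type*} [AddCommGroup V] [Module ℚ V] [FiniteDimensional ℚ V] {Q : QuadraticForm ℚ V}
    {U W : Submodule ℚ V} (hU : U.IsPosDef Q) (hW : W.IsPosDef Q)
    (h : finrank ℚ U < finrank ℚ W) :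
    ∃ w ∈ W, w ∉ U ∧ (U ⊔ ℚ ∙ w).IsPosDef Q ∧ finrank ℚ ↥(U ⊔ ℚ ∙ w) = finrank ℚ U + 1 := by
  have hker : LinearMap.ker (Q.polarBilin.compl₁₂ W.subtype U.subtype) ≠ ⊥ :=
    LinearMap.ker_ne_bot_of_finrank_lt (by rwa [Subspace.dual_finrank_eq])
  obtain ⟨⟨w, hwW⟩, hw, hw0⟩ := (Submodule.ne_bot_iff _).mp hker
  have hw0 : w ≠ 0 := fun h0 => hw0 (Subtype.ext h0)
  have horth : ∀ u ∈ U, QuadraticMap.polar Q w u = 0 := fun u hu =>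
    LinearMap.congr_fun (LinearMap.mem_ker.mp hw) ⟨u, hu⟩
  have hQw : 0 < Q w := hW w hwW hw0
  have hwU : w ∉ U := fun hwU => by
    have := horth w hwU
    rw [QuadraticMap.polar_self, two_nsmul] at this
    linarith
  refine ⟨w, hwW, hwU, ?_, le_antisymm ?_ ?_⟩
  · intro x hx hx0
    obtain ⟨u, hu, y, hy, rfl⟩ := Submodule.mem_sup.mp hx
    obtain ⟨c, rfl⟩ := Submodule.mem_span_singleton.mp hy
    have hsum : Q (u + c • w) = Q u + c * c * Q w := by
      rw [QuadraticMap.map_add Q, QuadraticMap.map_smul, QuadraticMap.polar_smul_right,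
        QuadraticMap.polar_comm, horth u hu]
      simp
    rw [hsum]
    rcases eq_or_ne u 0 with rfl | hu0
    · have hc : c ≠ 0 := by
        rintro rfl
        simp at hx0
      have := mul_self_pos.mpr hc
      rw [QuadraticMap.map_zero]
      positivity
    · have := hU u hu hu0
      have := mul_self_nonneg c
      positivity
  · exact (Submodule.finrank_add_le_finrank_add_finrank _ _).trans
      (by rw [finrank_span_singleton hw0])
  · exact Submodule.finrank_lt_finrank_of_lt (left_lt_sup.mpr fun hle =>
      hwU (hle (Submodule.mem_span_singleton_self w)))

open Module in
/-- A positive definite subspace extends to one of the dimension of any given larger positive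
definite subspace. -/
theorem Submodule.IsPosDef.exists_le_finrank_eq
    {V : Type*} [AddCommGroup V] [Module ℚ V] [FiniteDimensional ℚ V] {Q : QuadraticForm ℚ V}
    {U W : Submodule ℚ V} (hU : U.IsPosDef Q) (hW : W.IsPosDef Q)
    (h : finrank ℚ U ≤ finrank ℚ W) :
    ∃ X : Submodule ℚ V, U ≤ X ∧ X.IsPosDef Q ∧ finrank ℚ X = finrank ℚ W := by
  rcases h.eq_or_lt with h | h
  · exact ⟨U, le_rfl, hU, h⟩
  · obtain ⟨w, -, -, hpos, hdim⟩ := hU.exists_sup_span_singleton hW h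
    obtain ⟨X, hX, hXpos, hXdim⟩ := hpos.exists_le_finrank_eq hW (by omega)
    exact ⟨X, le_sup_left.trans hX, hXpos, hXdim⟩
termination_by finrank ℚ W - finrank ℚ U

open Module in
/-- Any two positive definite subspaces of dimension `k` are related by the reflexive transitive
closure of adjacency, that is, of meeting in dimension `k - 1`. -/
theorem Submodule.IsPosDef.reflTransGen_finrank_inf
    {V : Type*} [AddCommGroup V] [Module ℚ V] [FiniteDimensional ℚ V] {Q : QuadraticForm ℚ V}
    {k : ℕ} (A B : {W : Submodule ℚ V // finrank ℚ W = k ∧ W.IsPosDef Q}) :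
    Relation.ReflTransGen
      (fun A B : {W : Submodule ℚ V // finrank ℚ W = k ∧ W.IsPosDef Q} =>
        finrank ℚ ↥(A.1 ⊓ B.1) = k - 1) A B := by
  obtain ⟨n, hn⟩ : ∃ n, k - finrank ℚ ↥(A.1 ⊓ B.1) = n := ⟨_, rfl⟩
  induction n using Nat.strong_induction_on generalizing A B with
  | _ n ih =>
  obtain ⟨W₁, hdim₁, hpos₁⟩ := A
  obtain ⟨W₂, hdim₂, hpos₂⟩ := B
  dsimp only at hn
  have hle : finrank ℚ ↥(W₁ ⊓ W₂) ≤ k := hdim₁ ▸ Submodule.finrank_mono inf_le_left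
  by_cases heq : finrank ℚ ↥(W₁ ⊓ W₂) = k
  · have h₁ := Submodule.eq_of_le_of_finrank_eq (inf_le_left : W₁ ⊓ W₂ ≤ W₁) (heq.trans hdim₁.symm)
    have h₂ := Submodule.eq_of_le_of_finrank_eq (inf_le_right : W₁ ⊓ W₂ ≤ W₂) (heq.trans hdim₂.symm)
    obtain rfl : W₁ = W₂ := h₁.symm.trans h₂
    exact .refl
  by_cases hadj : finrank ℚ ↥(W₁ ⊓ W₂) = k - 1
  · exact .single hadj
  have hD : (W₁ ⊓ W₂).IsPosDef Q := fun w hw => hpos₁ w hw.1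
  obtain ⟨x, hxW, hxD, hxpos, hxdim⟩ := hD.exists_sup_span_singleton hpos₁ (by omega)
  obtain ⟨z, hzW, hzD, hzpos, hzdim⟩ := hxpos.exists_sup_span_singleton hpos₂ (by omega)
  obtain ⟨X, hX, hXpos, hXdim⟩ := hzpos.exists_le_finrank_eq hpos₁ (by omega)
  have hDX : W₁ ⊓ W₂ ≤ X := le_sup_left.trans (le_sup_left.trans hX)
  have hxX : x ∈ X := hX (le_sup_left (a := W₁ ⊓ W₂ ⊔ ℚ ∙ x)
    (Submodule.mem_sup_right (Submodule.mem_span_singleton_self x)))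
  have hzX : z ∈ X := hX (Submodule.mem_sup_right (Submodule.mem_span_singleton_self z))
  have h₁ : finrank ℚ ↥(W₁ ⊓ W₂) < finrank ℚ ↥(W₁ ⊓ X) :=
    Submodule.finrank_lt_finrank_of_lt
      (SetLike.lt_iff_le_and_exists.mpr ⟨le_inf inf_le_left hDX, x,
        Submodule.mem_inf.mpr ⟨hxW, hxX⟩, hxD⟩)
  have h₂ : finrank ℚ ↥(W₁ ⊓ W₂) < finrank ℚ ↥(X ⊓ W₂) :=
    Submodule.finrank_lt_finrank_of_lt
      (SetLike.lt_iff_le_and_exists.mpr ⟨le_inf hDX inf_le_right, z,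
        Submodule.mem_inf.mpr ⟨hzX, hzW⟩, fun hz => hzD (Submodule.mem_sup_left hz)⟩)
  exact (ih _ (by dsimp only; omega) ⟨W₁, hdim₁, hpos₁⟩ ⟨X, hXdim.trans hdim₁, hXpos⟩ rfl).trans
    (ih _ (by dsimp only; omega) ⟨X, hXdim.trans hdim₁, hXpos⟩ ⟨W₂, hdim₂, hpos₂⟩ rfl)

theorem RelSeries.exists_head_eq_last_eq_of_reflTransGen {α : Type*} {r : α → α → Prop} {a b : α}
    (h : Relation.ReflTransGen r a b) :
    ∃ s : RelSeries {p : α × α | r p.1 p.2}, s.head = a ∧ s.last = b := by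
  induction h with
  | refl => exact ⟨.singleton _ a, rfl, rfl⟩
  | tail _ hbc ih =>
    obtain ⟨s, hs, rfl⟩ := ih
    exact ⟨s.snoc _ hbc, by simpa using hs, by simp⟩


/-- Chain-connectedness of `k`-dimensional positive definite subspaces of an
anisotropic rational quadratic space: any two such subspaces `W₁`, `W₂` are
connected by a chain `U₀ = W₁, U₁, …, U_t = W₂` of `k`-dimensional positive
definite subspaces with `dim (Uᵢ ∩ Uᵢ₊₁) = k - 1` (proof of Lemma 3.4). -/
theorem chain_connected_posdef_subspaces
    {V : Type*} [AddCommGroup V] [Module ℚ V] [FiniteDimensional ℚ V]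
    (Q : QuadraticForm ℚ V) (hQ : Q.Anisotropic)
    (k : ℕ) (hk : 1 ≤ k)
    (W₁ W₂ : Submodule ℚ V)
    (hdim₁ : Module.finrank ℚ W₁ = k) (hpos₁ : W₁.IsPosDef Q)
    (hdim₂ : Module.finrank ℚ W₂ = k) (hpos₂ : W₂.IsPosDef Q) :
    ∃ (t : ℕ) (U : Fin (t + 1) → Submodule ℚ V),
      U 0 = W₁ ∧ U (Fin.last t) = W₂ ∧
      (∀ i, Module.finrank ℚ (U i) = k ∧ (U i).IsPosDef Q) ∧
      (∀ i : Fin t,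
        Module.finrank ℚ ↥(U i.castSucc ⊓ U i.succ) = k - 1) := by
  obtain ⟨s, hs₁, hs₂⟩ := RelSeries.exists_head_eq_last_eq_of_reflTransGen
    (Submodule.IsPosDef.reflTransGen_finrank_inf (Q := Q) (k := k)
      ⟨W₁, hdim₁, hpos₁⟩ ⟨W₂, hdim₂, hpos₂⟩)
  exact ⟨s.length, fun i => (s i).1, congrArg Subtype.val hs₁, congrArg Subtype.val hs₂,
    fun i => (s i).2, s.step⟩
end

section
/- Let (V,q) be a finite-dimensional quadratic space over ℚ, let k ≥ 1, and let W₁, W₂ be k-dimensional positive definite subspaces of V with dim(W₁ ∩ W₂) < k−1. Then there exists a k-dimensional positive definite subspace U ⊆ V such that dim(W₁ ∩ U) = k−1 and dim(W₂ ∩ U) > dim(W₁ ∩ W₂). -/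
namespace Submodule

variable {K V : Type*} [Field K] [AddCommGroup V] [Module K V]

/-- Every proper subspace of a finite-dimensional subspace `W` is contained in a hyperplane
of `W`. -/
theorem exists_hyperplane_of_lt {P W : Submodule K V} [FiniteDimensional K W] (h : P < W) :
    ∃ H : Submodule K V, P ≤ H ∧ H ≤ W ∧ Module.finrank K H + 1 = Module.finrank K W := by
  have hP : P.comap W.subtype < ⊤ := by
    rw [lt_top_iff_ne_top, Ne, comap_subtype_eq_top]
    exact h.not_ge
  obtain ⟨f, hf, hPf⟩ := exists_le_ker_of_lt_top _ hP
  refine ⟨(LinearMap.ker f).map W.subtype, fun x hx => ?_, map_subtype_le _ _, ?_⟩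
  · exact ⟨⟨x, h.le hx⟩, hPf hx, rfl⟩
  · rw [finrank_map_subtype_eq]
    exact Module.Dual.finrank_ker_add_one_of_ne_zero hf

/-- If `dim H < dim W`, then `W` contains a nonzero vector orthogonal to `H` with respect to
a given bilinear form. -/
theorem exists_mem_ne_zero_orthogonal_of_finrank_lt (B : LinearMap.BilinForm K V)
    {H W : Submodule K V} [FiniteDimensional K H] [FiniteDimensional K W]
    (h : Module.finrank K H < Module.finrank K W) :
    ∃ w ∈ W, w ≠ 0 ∧ ∀ u ∈ H, B w u = 0 := by
  let φ : W →ₗ[K] Module.Dual K H := H.dualRestrict ∘ₗ B ∘ₗ W.subtype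
  have hφ : LinearMap.ker φ ≠ ⊥ :=
    LinearMap.ker_ne_bot_of_finrank_lt (by rwa [Subspace.dual_finrank_eq])
  obtain ⟨w, hw, hw0⟩ := exists_mem_ne_zero_of_ne_bot hφ
  exact ⟨w, w.2, by simpa using hw0, fun u hu => LinearMap.congr_fun hw ⟨u, hu⟩⟩

end Submodule

/-- The orthogonal sum of a positive definite subspace and a line spanned by a vector of
positive norm is positive definite. -/
theorem Submodule.IsPosDef.sup_span_singleton {V : Type*} [AddCommGroup V] [Module ℚ V]
    {Q : QuadraticForm ℚ V} {H : Submodule ℚ V} (hH : H.IsPosDef Q) {w : V} (hw : 0 < Q w)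
    (horth : ∀ u ∈ H, Q.polarBilin w u = 0) : (H ⊔ ℚ ∙ w).IsPosDef Q := by
  intro x hx hx0
  obtain ⟨u, hu, v, hv, rfl⟩ := mem_sup.mp hx
  obtain ⟨c, rfl⟩ := mem_span_singleton.mp hv
  have horth' : QuadraticMap.polar Q u (c • w) = 0 := by
    rw [QuadraticMap.polar_smul_right, QuadraticMap.polar_comm]
    simpa using Or.inr (horth u hu)
  have hQ : Q (u + c • w) = Q u + c * c * Q w := by
    rw [QuadraticMap.map_add Q, horth', QuadraticMap.map_smul, smul_eq_mul, add_zero]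
  rw [hQ]
  rcases eq_or_ne u 0 with rfl | hu0
  · have hc : c ≠ 0 := by
      rintro rfl
      simp at hx0
    rw [QuadraticMap.map_zero, zero_add]
    exact mul_pos (mul_self_pos.mpr hc) hw
  · exact add_pos_of_pos_of_nonneg (hH u hu hu0) (mul_nonneg (mul_self_nonneg c) hw.le)

/-- Induction step in the proof of Lemma 3.4: given two `k`-dimensional
positive definite subspaces `W₁`, `W₂` of a rational quadratic space with
`dim (W₁ ∩ W₂) < k - 1`, there is a `k`-dimensional positive definite subspace
`U` with `dim (W₁ ∩ U) = k - 1` and `dim (W₂ ∩ U) > dim (W₁ ∩ W₂)`. -/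
theorem exists_posdef_subspace_closer
    {V : Type*} [AddCommGroup V] [Module ℚ V] [FiniteDimensional ℚ V]
    (Q : QuadraticForm ℚ V)
    (k : ℕ) (hk : 1 ≤ k)
    (W₁ W₂ : Submodule ℚ V)
    (hdim₁ : Module.finrank ℚ W₁ = k) (hpos₁ : W₁.IsPosDef Q)
    (hdim₂ : Module.finrank ℚ W₂ = k) (hpos₂ : W₂.IsPosDef Q)
    (hlt : Module.finrank ℚ ↥(W₁ ⊓ W₂) < k - 1) :
    ∃ U : Submodule ℚ V,
      Module.finrank ℚ U = k ∧ U.IsPosDef Q ∧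
      Module.finrank ℚ ↥(W₁ ⊓ U) = k - 1 ∧
      Module.finrank ℚ ↥(W₁ ⊓ W₂) < Module.finrank ℚ ↥(W₂ ⊓ U) := by
  have hlt₁ : W₁ ⊓ W₂ < W₁ := by
    refine lt_of_le_of_ne inf_le_left fun h => ?_
    rw [h] at hlt
    omega
  obtain ⟨H, hPH, hHW, hH⟩ := Submodule.exists_hyperplane_of_lt hlt₁
  obtain ⟨w, hw₂, hw0, horth⟩ := Submodule.exists_mem_ne_zero_orthogonal_of_finrank_lt
    Q.polarBilin (H := H) (W := W₂) (by omega)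
  have hQw : 0 < Q w := hpos₂ w hw₂ hw0
  have hw₁ : w ∉ W₁ := by
    intro hw₁
    have hself := horth w (hPH ⟨hw₁, hw₂⟩)
    rw [QuadraticMap.polarBilin_apply_apply, QuadraticMap.polar_self, nsmul_eq_mul] at hself
    norm_num at hself
    exact hQw.ne' hself
  have hdisj : Disjoint W₁ (ℚ ∙ w) := (Submodule.disjoint_span_singleton' hw0).mpr hw₁
  have hinf : W₁ ⊓ (H ⊔ ℚ ∙ w) = H := by
    rw [inf_comm, sup_inf_assoc_of_le _ hHW, inf_comm, hdisj.eq_bot, sup_bot_eq]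
  have hw_mem : w ∈ H ⊔ ℚ ∙ w :=
    Submodule.mem_sup_right (Submodule.mem_span_singleton_self w)
  refine ⟨H ⊔ ℚ ∙ w, ?_, ?_, ?_, ?_⟩
  · have hsum := Submodule.finrank_sup_add_finrank_inf_eq H (ℚ ∙ w)
    rw [(hdisj.mono_left hHW).eq_bot, finrank_bot, finrank_span_singleton hw0] at hsum
    omega
  · exact Submodule.IsPosDef.sup_span_singleton (fun u hu => hpos₁ u (hHW hu)) hQw horth
  · rw [hinf]
    omega
  · refine Submodule.finrank_lt_finrank_of_lt (SetLike.lt_iff_le_and_exists.mpr ⟨?_, w, ?_, ?_⟩)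
    · exact le_inf inf_le_right (hPH.trans le_sup_left)
    · exact ⟨hw₂, hw_mem⟩
    · exact fun h => hw₁ h.1
end

section
/- Let (V,q) be a finite-dimensional quadratic space over ℚ with q anisotropic, and let k ≥ 1. Let 𝒫_k denote the set of k-dimensional positive definite subspaces of V, let Z be the free abelian group on 𝒫_k (finitely supported ℤ-valued functions on 𝒫_k), and let weight : Z → ℤ be the homomorphism sending a formal sum Σ a_W · δ_W to Σ a_W. Then the kernel of weight is generated, as an abelian group, by the elements δ_{W₁} − δ_{W₂} with W₁, W₂ ∈ 𝒫_k satisfying dim(W₁ ∩ W₂) = k−1. -/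
/-- The set `𝒫ₖ` of `k`-dimensional positive definite subspaces of `(V, Q)`. -/
def PosDefSubspace {V : Type*} [AddCommGroup V] [Module ℚ V]
    (Q : QuadraticForm ℚ V) (k : ℕ) : Type _ :=
  {W : Submodule ℚ V // Module.finrank ℚ W = k ∧ W.IsPosDef Q}

/-- A finite-dimensional subspace contains subspaces of every smaller dimension. -/
theorem Submodule.exists_le_finrank_eq {K V : Type*} [Field K] [AddCommGroup V] [Module K V]
    [FiniteDimensional K V] (W : Submodule K V) (n : ℕ) (hn : n ≤ Module.finrank K W) :
    ∃ T ≤ W, Module.finrank K T = n := by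
  induction n with
  | zero => exact ⟨⊥, bot_le, finrank_bot K V⟩
  | succ n ih =>
    obtain ⟨T, hTW, hT⟩ := ih (by omega)
    have hWT : ¬ W ≤ T := fun h => by
      have := Submodule.finrank_mono h
      omega
    obtain ⟨v, hvW, hvT⟩ := SetLike.not_le_iff_exists.1 hWT
    exact ⟨T ⊔ K ∙ v, sup_le hTW ((Submodule.span_singleton_le_iff_mem v W).2 hvW),
      by rw [Submodule.finrank_sup_span_singleton hvT, hT]⟩

/-- A subspace `W` contains a subspace orthogonal to `J` of every dimension at most
`dim W - dim J`. -/
theorem QuadraticMap.exists_le_finrank_eq_polar_eq_zero {K V : Type*} [Field K] [AddCommGroup V]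
    [Module K V] [FiniteDimensional K V] (Q : QuadraticForm K V) (J W : Submodule K V) (n : ℕ)
    (hn : n + Module.finrank K J ≤ Module.finrank K W) :
    ∃ T ≤ W, Module.finrank K T = n ∧ ∀ t ∈ T, ∀ j ∈ J, QuadraticMap.polar Q t j = 0 := by
  let f : V →ₗ[K] Module.Dual K J := J.dualRestrict ∘ₗ Q.polarBilin
  have h₁ := f.finrank_range_add_finrank_ker
  have h₂ : Module.finrank K (LinearMap.range f) ≤ Module.finrank K J :=
    (Submodule.finrank_le _).trans_eq Subspace.dual_finrank_eq
  have h₃ := Submodule.finrank_sup_add_finrank_inf_eq W (LinearMap.ker f)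
  have h₄ := Submodule.finrank_le (W ⊔ LinearMap.ker f)
  obtain ⟨T, hT, hTn⟩ := (W ⊓ LinearMap.ker f).exists_le_finrank_eq n (by omega)
  refine ⟨T, hT.trans inf_le_left, hTn, fun t ht j hj => ?_⟩
  exact LinearMap.congr_fun (LinearMap.mem_ker.1 (hT ht).2) ⟨j, hj⟩

section PosDef

variable {V : Type*} [AddCommGroup V] [Module ℚ V] {Q : QuadraticForm ℚ V}

theorem Submodule.IsPosDef.mono {S T : Submodule ℚ V} (hT : T.IsPosDef Q) (h : S ≤ T) :
    S.IsPosDef Q :=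
  fun w hw => hT w (h hw)

theorem Submodule.IsPosDef.nonneg {W : Submodule ℚ V} (hW : W.IsPosDef Q) {w : V} (hw : w ∈ W) :
    0 ≤ Q w := by
  rcases eq_or_ne w 0 with rfl | h
  · simp
  · exact (hW w hw h).le

theorem Submodule.IsPosDef.sup {S T : Submodule ℚ V} (hS : S.IsPosDef Q) (hT : T.IsPosDef Q)
    (h : ∀ s ∈ S, ∀ t ∈ T, QuadraticMap.polar Q s t = 0) : (S ⊔ T).IsPosDef Q := by
  intro w hw hw0
  obtain ⟨s, hs, t, ht, rfl⟩ := Submodule.mem_sup.1 hw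
  rw [QuadraticMap.map_add Q s t, h s hs t ht, add_zero]
  rcases eq_or_ne s 0 with rfl | hs0
  · simpa using hT t ht (by simpa using hw0)
  · exact add_pos_of_pos_of_nonneg (hS s hs hs0) (hT.nonneg ht)

theorem Submodule.IsPosDef.disjoint {S T : Submodule ℚ V} (hS : S.IsPosDef Q)
    (h : ∀ s ∈ S, ∀ t ∈ T, QuadraticMap.polar Q s t = 0) : Disjoint S T := by
  rw [Submodule.disjoint_def]
  intro x hxS hxT
  by_contra hx
  have h₁ := h x hxS x hxT
  have h₂ := hS x hxS hx
  rw [QuadraticMap.polar_self, two_nsmul] at h₁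
  linarith

variable [FiniteDimensional ℚ V] {k : ℕ}

/-- Given two distinct `k`-dimensional positive definite subspaces, there is another one whose
intersection with the first has larger dimension than that of the second with the first, and whose
intersection with the second has dimension at least `k - 1`. -/
theorem PosDefSubspace.exists_step (W₁ W₂ : PosDefSubspace Q k)
    (h : Module.finrank ℚ ↥(W₁.1 ⊓ W₂.1) < k) :
    ∃ U : PosDefSubspace Q k,
      Module.finrank ℚ ↥(W₁.1 ⊓ W₂.1) + 1 ≤ Module.finrank ℚ ↥(W₁.1 ⊓ U.1) ∧
      k - 1 ≤ Module.finrank ℚ ↥(U.1 ⊓ W₂.1) := by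
  obtain ⟨W₁, hd₁, hp₁⟩ := W₁
  obtain ⟨W₂, hd₂, hp₂⟩ := W₂
  dsimp only at h ⊢
  have hle : ¬ W₁ ≤ W₁ ⊓ W₂ := fun hle => by
    have := Submodule.finrank_mono hle
    omega
  obtain ⟨a, haW, haI⟩ := SetLike.not_le_iff_exists.1 hle
  set I := W₁ ⊓ W₂ with hI
  have hJd := Submodule.finrank_sup_span_singleton haI
  have hJW : I ⊔ ℚ ∙ a ≤ W₁ := sup_le inf_le_left ((Submodule.span_singleton_le_iff_mem a W₁).2 haW)
  have hIJ : I ≤ I ⊔ ℚ ∙ a := le_sup_left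
  set J := I ⊔ ℚ ∙ a
  obtain ⟨T, hTW, hTd, hTJ⟩ := Q.exists_le_finrank_eq_polar_eq_zero J W₂
    (k - (Module.finrank ℚ I + 1)) (by omega)
  have hJT : ∀ s ∈ J, ∀ t ∈ T, QuadraticMap.polar Q s t = 0 := fun s hs t ht => by
    rw [QuadraticMap.polar_comm]
    exact hTJ t ht s hs
  have hJp := hp₁.mono hJW
  have hdim := Submodule.finrank_sup_add_finrank_inf_eq J T
  rw [(hJp.disjoint hJT).eq_bot, finrank_bot] at hdim
  have hdim' := Submodule.finrank_sup_add_finrank_inf_eq I T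
  rw [((hJp.disjoint hJT).mono_left hIJ).eq_bot, finrank_bot] at hdim'
  refine ⟨⟨J ⊔ T, by omega, hJp.sup (hp₂.mono hTW) hJT⟩, ?_, ?_⟩
  · rw [← hJd]
    exact Submodule.finrank_mono (le_inf hJW le_sup_left)
  · have hIT : I ⊔ T ≤ (J ⊔ T) ⊓ W₂ :=
      le_inf (sup_le_sup_right hIJ T) (sup_le inf_le_right hTW)
    have := Submodule.finrank_mono hIT
    dsimp only
    omega

theorem PosDefSubspace.eq_of_le_finrank_inf (W₁ W₂ : PosDefSubspace Q k)
    (h : k ≤ Module.finrank ℚ ↥(W₁.1 ⊓ W₂.1)) : W₁ = W₂ := by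
  have h₁ := Submodule.eq_of_le_of_finrank_le (inf_le_left : W₁.1 ⊓ W₂.1 ≤ W₁.1) (by rwa [W₁.2.1])
  have h₂ := Submodule.eq_of_le_of_finrank_le (inf_le_right : W₁.1 ⊓ W₂.1 ≤ W₂.1) (by rwa [W₂.2.1])
  exact Subtype.ext (h₁.symm.trans h₂)

theorem PosDefSubspace.single_sub_single_mem_closure (W₁ W₂ : PosDefSubspace Q k) :
    (Finsupp.single W₁ 1 - Finsupp.single W₂ 1 : PosDefSubspace Q k →₀ ℤ) ∈ AddSubgroup.closure
      {z' : PosDefSubspace Q k →₀ ℤ |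
        ∃ W₁ W₂ : PosDefSubspace Q k,
          Module.finrank ℚ ↥(W₁.1 ⊓ W₂.1) = k - 1 ∧
          z' = Finsupp.single W₁ 1 - Finsupp.single W₂ 1} := by
  obtain ⟨n, hn⟩ : ∃ n, k ≤ Module.finrank ℚ ↥(W₁.1 ⊓ W₂.1) + n := ⟨k, Nat.le_add_left _ _⟩
  induction n generalizing W₂ with
  | zero =>
    rw [W₁.eq_of_le_finrank_inf W₂ hn, sub_self]
    exact zero_mem _
  | succ n ih =>
    rcases lt_or_ge (Module.finrank ℚ ↥(W₁.1 ⊓ W₂.1)) k with h | h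
    · obtain ⟨U, hU₁, hU₂⟩ := W₁.exists_step W₂ h
      rw [← sub_add_sub_cancel _ (Finsupp.single U 1)]
      refine add_mem (ih U (by omega)) ?_
      rcases hU₂.eq_or_lt with hU | hU
      · exact AddSubgroup.subset_closure ⟨U, W₂, hU.symm, rfl⟩
      · rw [U.eq_of_le_finrank_inf W₂ (by omega), sub_self]
        exact zero_mem _
    · rw [W₁.eq_of_le_finrank_inf W₂ h, sub_self]
      exact zero_mem _

end PosDef

/-- A subgroup of a free abelian group containing all differences of basis elements contains
every element of weight zero. -/
theorem Finsupp.mem_of_sum_eq_zero {α : Type*} (H : AddSubgroup (α →₀ ℤ))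
    (hH : ∀ a b : α, Finsupp.single a 1 - Finsupp.single b 1 ∈ H) (z : α →₀ ℤ)
    (hz : (z.sum fun _ n => n) = 0) : z ∈ H := by
  rcases isEmpty_or_nonempty α with hα | ⟨⟨b⟩⟩
  · rw [Subsingleton.elim z 0]
    exact zero_mem H
  · have key : z = z.sum fun a n => n • (Finsupp.single a 1 - Finsupp.single b 1) := by
      simp only [smul_sub, Finsupp.smul_single, smul_eq_mul, mul_one]
      rw [Finsupp.sum_sub, Finsupp.sum_single, ← Finsupp.single_sum, hz,
        Finsupp.single_zero, sub_zero]
    rw [key]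
    exact sum_mem fun a _ => zsmul_mem (hH a b) _

/-- Group-theoretic content of Lemma 3.4: for an anisotropic rational quadratic
space `(V, Q)`, the kernel of the weight map
`weight : ℤ[𝒫ₖ] → ℤ, Σ a_W δ_W ↦ Σ a_W` on the free abelian group on the set
`𝒫ₖ` of `k`-dimensional positive definite subspaces of `V` is generated by the
differences `δ_{W₁} - δ_{W₂}` with `dim (W₁ ∩ W₂) = k - 1`. -/
theorem ker_weight_eq_closure_differences
    {V : Type*} [AddCommGroup V] [Module ℚ V] [FiniteDimensional ℚ V]
    (Q : QuadraticForm ℚ V) (hQ : Q.Anisotropic)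
    (k : ℕ) (hk : 1 ≤ k) :
    ∀ z : PosDefSubspace Q k →₀ ℤ,
      z ∈ AddSubgroup.closure
        {z' : PosDefSubspace Q k →₀ ℤ |
          ∃ W₁ W₂ : PosDefSubspace Q k,
            Module.finrank ℚ ↥(W₁.1 ⊓ W₂.1) = k - 1 ∧
            z' = Finsupp.single W₁ 1 - Finsupp.single W₂ 1} ↔
      z.sum (fun _ a => a) = 0 := by
  intro z
  constructor
  · intro hz
    induction hz using AddSubgroup.closure_induction with
    | mem x hx =>
      obtain ⟨W₁, W₂, -, rfl⟩ := hx
      rw [Finsupp.sum_sub_index fun _ _ _ => rfl]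
      simp
    | zero => simp
    | add x y _ _ hx hy =>
      rw [Finsupp.sum_add_index' (fun _ => rfl) fun _ _ _ => rfl, hx, hy, add_zero]
    | neg x _ hx =>
      rw [Finsupp.sum_neg_index fun _ => rfl]
      simpa [Finsupp.sum] using hx
  · exact Finsupp.mem_of_sum_eq_zero _ PosDefSubspace.single_sub_single_mem_closure z
end

section
/- Let F be an algebraically closed field of characteristic different from 2 and let (V,q) be a nondegenerate quadratic space over F of dimension n. Let W, W' ⊆ V be subspaces on which the restriction of q is nondegenerate, with dim W ≤ n−2 and dim W' ≤ n−2. If the sets of isotropic vectors {v ∈ W^⊥ : q(v) = 0} and {v ∈ (W')^⊥ : q(v) = 0} coincide, then W = W'. -/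
section IsotropicSpan

variable {F V : Type*} [Field F] [AddCommGroup V] [Module F V]

/-- Over an algebraically closed field of characteristic `≠ 2`, a quadratic form has a nonzero
isotropic vector in every subspace of dimension at least two. -/
theorem QuadraticForm.exists_isotropic_mem [IsAlgClosed F] (h2 : (2 : F) ≠ 0)
    (Q : QuadraticForm F V) (U : Submodule F V) (hU : 2 ≤ Module.finrank F U) :
    ∃ y ∈ U, y ≠ 0 ∧ Q y = 0 := by
  have : NeZero (2 : F) := ⟨h2⟩
  obtain ⟨f, hf⟩ := exists_linearIndependent_of_le_finrank hU
  have hf' := LinearIndependent.pair_iff.1 (show LinearIndependent F ![f 0, f 1] by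
    convert hf using 1
    ext i
    fin_cases i <;> rfl)
  by_cases hb : Q (f 1 : V) = 0
  · exact ⟨f 1, (f 1).2, fun h => hf.ne_zero 1 (Subtype.ext h), hb⟩
  · obtain ⟨s, hs⟩ := IsAlgClosed.exists_eq_mul_self
      (discrim (Q (f 1 : V)) (QuadraticMap.polar Q (f 0 : V) (f 1)) (Q (f 0 : V)))
    obtain ⟨t, ht⟩ := exists_quadratic_eq_zero hb ⟨s, hs⟩
    refine ⟨f 0 + t • f 1, U.add_mem (f 0).2 (U.smul_mem t (f 1).2), fun h => ?_, ?_⟩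
    · exact one_ne_zero (hf' 1 t (Subtype.ext (by simpa using h))).1
    · rw [QuadraticMap.map_add Q, QuadraticMap.map_smul, QuadraticMap.polar_smul_right]
      simp only [smul_eq_mul]
      linear_combination ht

/-- A subspace containing an isotropic vector outside its radical is spanned by its isotropic
vectors. -/
theorem QuadraticForm.le_of_isotropic_subset (Q : QuadraticForm F V) (U P : Submodule F V)
    {y z : V} (hy : y ∈ U) (hQy : Q y = 0) (hz : z ∈ U) (hyz : QuadraticMap.polar Q y z ≠ 0)
    (h : ∀ v ∈ U, Q v = 0 → v ∈ P) : U ≤ P := by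
  have key : ∀ v ∈ U, QuadraticMap.polar Q y v ≠ 0 → v ∈ P := by
    intro v hv hyv
    set c := -(Q v / QuadraticMap.polar Q y v) with hc
    have hmem : v + c • y ∈ P := by
      refine h _ (U.add_mem hv (U.smul_mem _ hy)) ?_
      rw [QuadraticMap.map_add Q, QuadraticMap.map_smul, QuadraticMap.polar_smul_right,
        QuadraticMap.polar_comm, hQy, hc]
      simp only [smul_eq_mul]
      field_simp
      ring
    exact (P.add_mem_iff_left (P.smul_mem c (h y hy hQy))).1 hmem
  intro v hv
  by_cases hyv : QuadraticMap.polar Q y v = 0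
  · refine (P.add_mem_iff_left (key z hz hyz)).1 (key _ (U.add_mem hv hz) ?_)
    rwa [QuadraticMap.polar_add_right, hyv, zero_add]
  · exact key v hv hyv

/-- The orthogonal complement of a nondegenerate subspace of codimension at least two is spanned
by its isotropic vectors. -/
theorem QuadraticForm.orthogonal_le_of_isotropic_subset [IsAlgClosed F] (h2 : (2 : F) ≠ 0)
    [FiniteDimensional F V] (Q : QuadraticForm F V)
    (hnd : ∀ v : V, (∀ w : V, QuadraticMap.polar Q v w = 0) → v = 0)
    (W P : Submodule F V)
    (hndW : ∀ w ∈ W, (∀ w' ∈ W, QuadraticMap.polar Q w w' = 0) → w = 0)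
    (hdW : Module.finrank F W + 2 ≤ Module.finrank F V)
    (h : ∀ v ∈ LinearMap.BilinForm.orthogonal Q.polarBilin W, Q v = 0 → v ∈ P) :
    LinearMap.BilinForm.orthogonal Q.polarBilin W ≤ P := by
  have hrefl : LinearMap.BilinForm.IsRefl Q.polarBilin := fun x y hxy => by
    simpa [QuadraticMap.polar_comm] using hxy
  have hcompl : IsCompl W (LinearMap.BilinForm.orthogonal Q.polarBilin W) := by
    rw [LinearMap.BilinForm.isCompl_orthogonal_iff_disjoint hrefl, Submodule.disjoint_def]
    intro w hw hw'
    exact hndW w hw fun u hu => (QuadraticMap.polar_comm Q w u).trans (hw' u hu)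
  have hdim := Submodule.finrank_add_eq_of_isCompl hcompl
  obtain ⟨y, hy, hy0, hQy⟩ := Q.exists_isotropic_mem h2
    (LinearMap.BilinForm.orthogonal Q.polarBilin W) (by omega)
  obtain ⟨z, hz, hyz⟩ : ∃ z ∈ LinearMap.BilinForm.orthogonal Q.polarBilin W,
      QuadraticMap.polar Q y z ≠ 0 := by
    by_contra! hcon
    refine hy0 (hnd y fun v => ?_)
    obtain ⟨a, ha, b, hb, rfl⟩ := Submodule.mem_sup.1
      (hcompl.sup_eq_top ▸ Submodule.mem_top : v ∈ W ⊔ _)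
    rw [QuadraticMap.polar_add_right, hcon b hb, add_zero, QuadraticMap.polar_comm]
    exact hy a ha
  exact Q.le_of_isotropic_subset _ P hy hQy hz hyz h

end IsotropicSpan

/-- A special cycle determines its underlying subspace: over an algebraically
closed field of characteristic `≠ 2`, if `W, W'` are subspaces of a
nondegenerate quadratic space `(V, Q)` of dimension `n` on which `Q` restricts
nondegenerately, of dimensions `≤ n - 2`, and if the isotropic vectors of
`W^⊥` and of `(W')^⊥` coincide, then `W = W'`. -/
theorem subspace_eq_of_isotropic_perp_eq
    {F : Type*} [Field F] [IsAlgClosed F] (h2 : (2 : F) ≠ 0)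
    {V : Type*} [AddCommGroup V] [Module F V] [FiniteDimensional F V]
    (Q : QuadraticForm F V)
    (hnd : ∀ v : V, (∀ w : V, QuadraticMap.polar Q v w = 0) → v = 0)
    (W W' : Submodule F V)
    (hndW : ∀ w ∈ W, (∀ w' ∈ W, QuadraticMap.polar Q w w' = 0) → w = 0)
    (hndW' : ∀ w ∈ W', (∀ w' ∈ W', QuadraticMap.polar Q w w' = 0) → w = 0)
    (hdW : Module.finrank F W + 2 ≤ Module.finrank F V)
    (hdW' : Module.finrank F W' + 2 ≤ Module.finrank F V)
    (hiso : {v : V | (∀ w ∈ W, QuadraticMap.polar Q w v = 0) ∧ Q v = 0}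
          = {v : V | (∀ w ∈ W', QuadraticMap.polar Q w v = 0) ∧ Q v = 0}) :
    W = W' := by
  have hrefl : LinearMap.BilinForm.IsRefl Q.polarBilin := fun x y hxy => by
    simpa [QuadraticMap.polar_comm] using hxy
  have hB : LinearMap.BilinForm.Nondegenerate Q.polarBilin :=
    (LinearMap.IsRefl.nondegenerate_iff_separatingLeft hrefl).2 hnd
  have hperp : LinearMap.BilinForm.orthogonal Q.polarBilin W
      = LinearMap.BilinForm.orthogonal Q.polarBilin W' :=
    le_antisymm
      (Q.orthogonal_le_of_isotropic_subset h2 hnd W _ hndW hdW fun v hv hQ =>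
        (hiso.subset ⟨hv, hQ⟩).1)
      (Q.orthogonal_le_of_isotropic_subset h2 hnd W' _ hndW' hdW' fun v hv hQ =>
        (hiso.superset ⟨hv, hQ⟩).1)
  rw [← LinearMap.BilinForm.orthogonal_orthogonal hB hrefl W, hperp,
    LinearMap.BilinForm.orthogonal_orthogonal hB hrefl W']
end
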